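/- arXiv:2303.17321 — 5 statements merged into one kernel-verified Lean document; each statement's English description precedes it below -/
import Mathlib

section
/- There exists an orthogonal matrix T ∈ ℝ^{N×N} whose first column is (1/√N)𝟙_N such that L̄ := TᵀLT is block upper triangular with 1×1 or 2×2 diagonal blocks and zero first column; precisely: L̄ has first column equal to zero, L̄_{ij} = 0 whenever i > j+1, and for every index i, if the subdiagonal entry L̄_{i+1,i} is nonzero then the next subdiagonal entry L̄_{i+2,i+1} is zero. -/
open Matrix

section QuasiTriangularFlag

open Polynomial Module

variable {E : Type*} [AddCommGroup E] [Module ℝ E]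

/-- If a nonzero real polynomial in `f` sends some vector outside `U` into `U`, then so does an
irreducible one. -/
theorem exists_irreducible_aeval_mem (f : End ℝ E) (U : Submodule ℝ E) (p : ℝ[X]) (hp : p ≠ 0) :
    ∀ x ∉ U, aeval f p x ∈ U → ∃ q : ℝ[X], Irreducible q ∧ ∃ y ∉ U, aeval f q y ∈ U := by
  induction p using UniqueFactorizationMonoid.induction_on_prime with
  | h₁ => exact absurd rfl hp
  | h₂ p hunit =>
    intro x hx hpx
    obtain ⟨r, hr, rfl⟩ := Polynomial.isUnit_iff.1 hunit
    rw [aeval_C, Module.algebraMap_end_apply] at hpx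
    exact absurd ((U.smul_mem_iff hr.ne_zero).1 hpx) hx
  | h₃ a q ha hq ih =>
    intro x hx hpx
    by_cases hqx : aeval f q x ∈ U
    · exact ⟨q, hq.irreducible, x, hx, hqx⟩
    · refine ih ha _ hqx ?_
      rwa [mul_comm, map_mul, Module.End.mul_apply] at hpx

theorem exists_quadratic_mem_of_ne_top [FiniteDimensional ℝ E] (f : End ℝ E) (U : Submodule ℝ E)
    (hf : U ≤ U.comap f) (hU : U ≠ ⊤) :
    ∃ y ∉ U, ∃ b c : ℝ, f (f y) + b • f y + c • y ∈ U := by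
  obtain ⟨x, hx⟩ : ∃ x, x ∉ U := by
    by_contra! h
    exact hU (Submodule.eq_top_iff'.2 h)
  obtain ⟨q, hq, y, hy, hqy⟩ := exists_irreducible_aeval_mem f U (minpoly ℝ f)
    (minpoly.ne_zero (Algebra.IsIntegral.isIntegral f)) x hx (by simp [minpoly.aeval])
  refine ⟨y, hy, ?_⟩
  have hpos := hq.natDegree_pos
  have hq2 := eq_quadratic_of_degree_le_two hq.degree_le_two
  generalize q.coeff 2 = a, q.coeff 1 = b, q.coeff 0 = c at hq2
  subst hq2
  have hqy' : a • f (f y) + b • f y + c • y ∈ U := by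
    simpa [pow_two, Algebra.algebraMap_eq_smul_one] using hqy
  by_cases ha : a = 0
  · subst ha
    have hb : b ≠ 0 := by
      rintro rfl
      simp at hpos
    have h := U.smul_mem b⁻¹ (hf hqy')
    refine ⟨c / b, 0, ?_⟩
    convert h using 1
    simp [smul_smul, hb, div_eq_inv_mul]
  · refine ⟨b / a, c / a, ?_⟩
    convert U.smul_mem a⁻¹ hqy' using 1
    simp [smul_smul, ha, div_eq_inv_mul]

/-- A proper invariant subspace of a real endomorphism is properly contained in an invariant
subspace of dimension at most two more. -/
theorem exists_invariant_gt_finrank_le [FiniteDimensional ℝ E] (f : End ℝ E) (U : Submodule ℝ E)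
    (hf : U ≤ U.comap f) (hU : U ≠ ⊤) :
    ∃ V : Submodule ℝ E, U < V ∧ V ≤ V.comap f ∧ finrank ℝ V ≤ finrank ℝ U + 2 := by
  obtain ⟨y, hy, b, c, h⟩ := exists_quadratic_mem_of_ne_top f U hf hU
  have hspan : Submodule.span ℝ {y, f y} ≤ U ⊔ Submodule.span ℝ {y, f y} := le_sup_right
  have hyV : y ∈ U ⊔ Submodule.span ℝ {y, f y} := hspan (Submodule.subset_span (by simp))
  have hfyV : f y ∈ U ⊔ Submodule.span ℝ {y, f y} := hspan (Submodule.subset_span (by simp))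
  refine ⟨U ⊔ Submodule.span ℝ {y, f y}, lt_of_le_of_ne le_sup_left ?_, sup_le ?_ ?_, ?_⟩
  · intro h'
    exact hy (h' ▸ hyV)
  · exact hf.trans (Submodule.comap_mono le_sup_left)
  · rw [Submodule.span_le]
    rintro z (rfl | rfl)
    · exact hfyV
    · have := Submodule.sub_mem _ (Submodule.sub_mem _
        ((le_sup_left : U ≤ U ⊔ Submodule.span ℝ {y, f y}) h)
        (Submodule.smul_mem _ c hyV)) (Submodule.smul_mem _ b hfyV)
      rw [add_sub_cancel_right, add_sub_cancel_right] at this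
      exact this
  · refine (Submodule.finrank_add_le_finrank_add_finrank _ _).trans ?_
    gcongr
    classical
    have := finrank_span_finset_le_card (R := ℝ) ({y, f y} : Finset E)
    rw [Finset.coe_pair] at this
    exact this.trans Finset.card_le_two

/-- `U` is contained in an `f`-invariant subspace of dimension at most one more. -/
def IsNearlyInvariant (f : End ℝ E) (U : Submodule ℝ E) : Prop :=
  ∃ V : Submodule ℝ E, U ≤ V ∧ V ≤ V.comap f ∧ finrank ℝ V ≤ finrank ℝ U + 1

theorem exists_nearlyInvariant_gt [FiniteDimensional ℝ E] (f : End ℝ E) (U : Submodule ℝ E)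
    (h : IsNearlyInvariant f U) :
    ∃ V, IsNearlyInvariant f V ∧ U ≤ V ∧ (U ≠ ⊤ → U < V) ∧ finrank ℝ V ≤ finrank ℝ U + 1 ∧
      (U ≤ U.comap f ∨ V ≤ V.comap f) := by
  by_cases hf : U ≤ U.comap f
  · by_cases hU : U = ⊤
    · exact ⟨U, h, le_rfl, fun h' => absurd hU h', by omega, Or.inl hf⟩
    obtain ⟨V, hUV, hV, hr⟩ := exists_invariant_gt_finrank_le f U hf hU
    obtain ⟨x, hxV, hxU⟩ := SetLike.exists_of_lt hUV
    have hlt : U < U ⊔ Submodule.span ℝ {x} := by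
      refine lt_of_le_of_ne le_sup_left fun h' => hxU ?_
      rw [h']
      exact (le_sup_right : _ ≤ U ⊔ Submodule.span ℝ {x}) (Submodule.mem_span_singleton_self x)
    have hle : finrank ℝ ↥(U ⊔ Submodule.span ℝ {x}) ≤ finrank ℝ U + 1 := by
      refine (Submodule.finrank_add_le_finrank_add_finrank _ _).trans ?_
      gcongr
      simpa using finrank_span_le_card (R := ℝ) ({x} : Set E)
    have hr' := Submodule.finrank_lt_finrank_of_lt hlt
    refine ⟨U ⊔ Submodule.span ℝ {x}, ⟨V, sup_le hUV.le ?_, hV, by omega⟩, le_sup_left,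
      fun _ => hlt, hle, Or.inl hf⟩
    simpa using hxV
  · obtain ⟨V, hUV, hV, hr⟩ := h
    refine ⟨V, ⟨V, le_rfl, hV, by omega⟩, hUV, fun _ => lt_of_le_of_ne hUV ?_, hr, Or.inr hV⟩
    rintro rfl
    exact hf hV

/-- Every line invariant under `f` starts a flag in which no two consecutive subspaces both fail
to be invariant. -/
theorem exists_quasi_invariant_flag [FiniteDimensional ℝ E] (f : End ℝ E) (U : Submodule ℝ E)
    (hf : U ≤ U.comap f) (hU : finrank ℝ U ≤ 1) :
    ∃ F : ℕ → Submodule ℝ E, F 0 = U ∧ Monotone F ∧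
      (∀ k, k + 1 < finrank ℝ E → F k < F (k + 1)) ∧
      ∀ k, F k ≤ (F k).comap f ∨ F (k + 1) ≤ (F (k + 1)).comap f := by
  choose! g hg hle hlt hr hinv using exists_nearlyInvariant_gt f
  let F : ℕ → Submodule ℝ E := fun k => g^[k] U
  have hF (k) : F (k + 1) = g (F k) := Function.iterate_succ_apply' g k U
  have hnear (k) : IsNearlyInvariant f (F k) := by
    induction k with
    | zero => exact ⟨U, le_rfl, hf, Nat.le_succ _⟩
    | succ k ih => rw [hF]; exact hg _ ih
  have hdim (k) : finrank ℝ (F k) ≤ k + 1 := by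
    induction k with
    | zero => exact hU
    | succ k ih => rw [hF]; have := hr _ (hnear k); omega
  refine ⟨F, rfl, monotone_nat_of_le_succ fun k => ?_, fun k hk => ?_, fun k => ?_⟩
  · rw [hF]; exact hle _ (hnear k)
  · rw [hF]
    refine hlt _ (hnear k) fun htop => ?_
    have := hdim k
    rw [htop, finrank_top] at this
    omega
  · rw [hF]; exact hinv _ (hnear k)

end QuasiTriangularFlag

open Module in
/-- Real Schur form of an endomorphism of a Euclidean space, starting from a prescribed unit
eigenvector. -/
theorem exists_orthonormal_quasi_triangular {E : Type*} [NormedAddCommGroup E]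
    [InnerProductSpace ℝ E] [FiniteDimensional ℝ E] (f : End ℝ E) (u : E) (hu : ‖u‖ = 1)
    (hfu : f u ∈ Submodule.span ℝ {u}) :
    ∃ v : Fin (finrank ℝ E) → E, Orthonormal ℝ v ∧ (∀ i : Fin _, (i : ℕ) = 0 → v i = u) ∧
      (∀ i j : Fin _, (j : ℕ) + 1 < i → inner ℝ (v i) (f (v j)) = 0) ∧
      ∀ i j k : Fin _, (j : ℕ) = i + 1 → (k : ℕ) = j + 1 →
        inner ℝ (v j) (f (v i)) ≠ 0 → inner ℝ (v k) (f (v j)) = 0 := by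
  obtain ⟨F, hF0, hmono, hlt, hinv⟩ := exists_quasi_invariant_flag f (Submodule.span ℝ {u})
    (by simpa using hfu) (by simpa using finrank_span_le_card (R := ℝ) ({u} : Set E))
  have hex (k : ℕ) (hk : k + 1 < finrank ℝ E) :
      ∃ w ∈ F (k + 1), ‖w‖ = 1 ∧ ∀ z ∈ F k, inner ℝ w z = 0 := by
    obtain ⟨x, hx, hxk⟩ := SetLike.exists_of_lt (hlt k hk)
    let y := x - (F k).starProjection x
    have hy0 : y ≠ 0 := fun h => hxk (by
      rw [sub_eq_zero.1 h]; exact Submodule.starProjection_apply_mem _ _)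
    refine ⟨(‖y‖⁻¹ : ℝ) • y, Submodule.smul_mem _ _ (Submodule.sub_mem _ hx
      (hmono k.le_succ (Submodule.starProjection_apply_mem _ _))), ?_, fun z hz => ?_⟩
    · rw [norm_smul, norm_inv, norm_norm, inv_mul_cancel₀ (norm_ne_zero_iff.2 hy0)]
    · rw [inner_smul_left, Submodule.starProjection_inner_eq_zero x z hz, mul_zero]
  choose! w hwmem hwnorm hworth using hex
  let s : ℕ → E := fun k => Nat.casesOn k u w
  have hs_mem (k : ℕ) (hk : k < finrank ℝ E) : s k ∈ F k := by
    cases k with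
    | zero => rw [hF0]; exact Submodule.mem_span_singleton_self u
    | succ k => exact hwmem k hk
  have hs_norm (k : ℕ) (hk : k < finrank ℝ E) : ‖s k‖ = 1 := by
    cases k with
    | zero => exact hu
    | succ k => exact hwnorm k hk
  have hs_orth {j k : ℕ} (hk : k < finrank ℝ E) (hjk : j < k) {z : E} (hz : z ∈ F j) :
      inner ℝ (s k) z = 0 := by
    cases k with
    | zero => omega
    | succ k => exact hworth k hk z (hmono (Nat.le_of_lt_succ hjk) hz)
  refine ⟨fun i => s i, ⟨fun i => hs_norm i i.2, fun i j hij => ?_⟩, fun i hi => ?_,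
    fun i j hij => ?_, fun i j k hij hjk hne => ?_⟩
  · rcases lt_or_gt_of_ne (Fin.val_ne_of_ne hij) with h | h
    · rw [real_inner_comm]
      exact hs_orth j.2 h (hs_mem i i.2)
    · exact hs_orth i.2 h (hs_mem j j.2)
  · simp only [hi]
    rfl
  · rcases hinv j with h | h
    · exact hs_orth i.2 (by omega) (h (hs_mem j j.2))
    · exact hs_orth i.2 hij (h (hmono (Nat.le_succ _) (hs_mem j j.2)))
  · rcases hinv i with h | h
    · exact absurd (hs_orth j.2 (by omega) (h (hs_mem i i.2))) hne
    · rw [← hij] at h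
      exact hs_orth k.2 (by omega) (h (hs_mem j j.2))

theorem transpose_mul_mul_apply_eq_inner {n m : Type*} [Fintype n] [DecidableEq n]
    (A : Matrix n n ℝ) (v : m → EuclideanSpace ℝ n) (i j : m) :
    ((Matrix.of fun k l => v l k)ᵀ * A * (Matrix.of fun k l => v l k)) i j =
      inner ℝ (v i) (Matrix.toEuclideanLin A (v j)) := by
  rw [Matrix.mul_assoc]
  simp only [Matrix.mul_apply, transpose_apply, of_apply, PiLp.inner_apply,
    Matrix.ofLp_toLpLin, Matrix.toLin'_apply, mulVec, dotProduct, RCLike.inner_apply, conj_trivial]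
  exact Finset.sum_congr rfl fun k _ => mul_comm _ _

theorem laplacian_mulVec_one {n : Type*} [Fintype n] [DecidableEq n] (W : Matrix n n ℝ) :
    (Matrix.diagonal (W *ᵥ fun _ => 1) - W) *ᵥ (fun _ => 1) = 0 := by
  ext i
  simp [sub_mulVec, mulVec_diagonal]

/-- There is an orthogonal matrix `T` whose first column is `(1/√N)𝟙` putting the
Laplacian `L` into a real block upper triangular (quasi-triangular) form with `1×1` or
`2×2` diagonal blocks and zero first column. -/
theorem laplacian_real_schur_form
    (N : ℕ) (hN : 1 ≤ N) (W : Matrix (Fin N) (Fin N) ℝ)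
    (hW : ∀ i j, 0 ≤ W i j) (hdiag : ∀ i, W i i = 0)
    (D : Matrix (Fin N) (Fin N) ℝ)
    (hD : D = Matrix.diagonal (W *ᵥ (fun _ => 1)))
    (L : Matrix (Fin N) (Fin N) ℝ) (hL : L = D - W) :
    ∃ T : Matrix (Fin N) (Fin N) ℝ,
      Tᵀ * T = 1 ∧
      (∀ i : Fin N, T i ⟨0, hN⟩ = 1 / Real.sqrt N) ∧
      (∀ i : Fin N, (Tᵀ * L * T) i ⟨0, hN⟩ = 0) ∧
      (∀ i j : Fin N, (j : ℕ) + 1 < (i : ℕ) → (Tᵀ * L * T) i j = 0) ∧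
      (∀ i : ℕ, ∀ h2 : i + 2 < N,
        (Tᵀ * L * T) ⟨i + 1, by omega⟩ ⟨i, by omega⟩ ≠ 0 →
        (Tᵀ * L * T) ⟨i + 2, h2⟩ ⟨i + 1, by omega⟩ = 0) := by
  let u : EuclideanSpace ℝ (Fin N) := WithLp.toLp 2 fun _ => 1 / Real.sqrt N
  have hN0 : (0 : ℝ) < N := by exact_mod_cast hN
  have hu : ‖u‖ = 1 := by
    simp [u, EuclideanSpace.norm_eq, Real.sq_sqrt hN0.le, hN0.ne']
  have hLu : Matrix.toEuclideanLin L u = 0 := by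
    have hu' : u = (1 / Real.sqrt N) • WithLp.toLp 2 fun _ => 1 := by
      ext i
      simp [u]
    have h1 : Matrix.toEuclideanLin L (WithLp.toLp 2 fun _ => 1) = 0 := by
      rw [Matrix.toLpLin_toLp, Matrix.toLin'_apply, hL, hD, laplacian_mulVec_one]
      rfl
    rw [hu', map_smul, h1, smul_zero]
  have hex := exists_orthonormal_quasi_triangular (Matrix.toEuclideanLin L) u hu
    (by rw [hLu]; exact zero_mem _)
  rw [finrank_euclideanSpace_fin] at hex
  obtain ⟨v, hv, hv0, htri, hblock⟩ := hex
  refine ⟨Matrix.of fun i j => v j i, ?_, fun i => ?_, fun i => ?_, fun i j hij => ?_,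
    fun i h2 => ?_⟩
  · ext i j
    have h := transpose_mul_mul_apply_eq_inner 1 v i j
    rw [Matrix.mul_one] at h
    rw [h, Matrix.one_apply, ← orthonormal_iff_ite.1 hv i j]
    simp [Matrix.toLpLin_one]
  · rw [of_apply, hv0 _ rfl]
  · rw [transpose_mul_mul_apply_eq_inner, hv0 ⟨0, hN⟩ rfl, hLu, inner_zero_right]
  · rw [transpose_mul_mul_apply_eq_inner]
    exact htri i j hij
  · rw [transpose_mul_mul_apply_eq_inner, transpose_mul_mul_apply_eq_inner]
    exact hblock _ _ _ rfl rfl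
end

section
/- A matrix S ∈ ℂ^{n×n} is Hurwitz if and only if for every Hermitian positive definite matrix Q ∈ ℂ^{n×n} there exists a Hermitian positive definite matrix H ∈ ℂ^{n×n} such that S*H + HS = −Q, where S* denotes the conjugate transpose. -/
open Matrix
open scoped ComplexOrder

open Filter Topology in
/-- In a complex Banach algebra, an element whose spectrum lies in the open unit disc has
geometrically decaying powers. -/
theorem exists_eventually_norm_pow_le_of_spectrum_norm_lt_one
    {A : Type*} [NormedRing A] [NormedAlgebra ℂ A] [CompleteSpace A] (a : A)
    (ha : ∀ μ ∈ spectrum ℂ a, ‖μ‖ < 1) :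
    ∃ r : ℝ, 0 ≤ r ∧ r < 1 ∧ ∀ᶠ k : ℕ in atTop, ‖a ^ k‖ ≤ r ^ k := by
  have hρ : spectralRadius ℂ a < ((1 : NNReal) : ENNReal) := by
    rcases (spectrum ℂ a).eq_empty_or_nonempty with h | h
    · simp [spectralRadius, h]
    · exact spectrum.spectralRadius_lt_of_forall_lt_of_nonempty h fun μ hμ => by
        exact_mod_cast ha μ hμ
  obtain ⟨r, hr, hr1⟩ := ENNReal.lt_iff_exists_nnreal_btwn.1 hρ
  refine ⟨r, r.2, by exact_mod_cast hr1, ?_⟩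
  filter_upwards [(spectrum.pow_nnnorm_pow_one_div_tendsto_nhds_spectralRadius a).eventually_lt_const
    hr, eventually_gt_atTop 0] with k hk hk0
  have hk0' : (0 : ℝ) < k := by exact_mod_cast hk0
  rw [one_div, ENNReal.rpow_inv_lt_iff hk0', ENNReal.rpow_natCast] at hk
  exact_mod_cast hk.le

namespace Matrix

variable {m : Type*} [Fintype m]

/-- The sum of a convergent series of positive semidefinite matrices is positive semidefinite. -/
theorem PosSemidef.of_hasSum {ι : Type*} {f : ι → Matrix m m ℂ} {M : Matrix m m ℂ}
    (hf : ∀ i, (f i).PosSemidef) (hM : HasSum f M) : M.PosSemidef := by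
  refine .of_dotProduct_mulVec_nonneg ?_ fun x => ?_
  · have h := hM.matrix_conjTranspose
    simp only [(hf _).isHermitian.eq] at h
    exact h.unique hM
  · let φ : Matrix m m ℂ →+ ℂ :=
      { toFun := fun N => star x ⬝ᵥ (N *ᵥ x)
        map_zero' := by simp
        map_add' := fun N P => by rw [add_mulVec, dotProduct_add] }
    have hφ : Continuous φ := by
      change Continuous fun N : Matrix m m ℂ => star x ⬝ᵥ (N *ᵥ x)
      fun_prop
    exact (hM.map φ hφ).nonneg fun i => (hf i).dotProduct_mulVec_nonneg x

variable [DecidableEq m]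

open scoped Matrix.Norms.L2Operator in
/-- The Stein equation `H - Cᴴ H C = Q` has a positive definite solution when the spectrum of `C`
lies in the open unit disc and `Q` is positive definite. -/
theorem exists_posDef_sub_conjTranspose_mul_mul_eq {C Q : Matrix m m ℂ}
    (hC : ∀ μ ∈ spectrum ℂ C, ‖μ‖ < 1) (hQ : Q.PosDef) :
    ∃ H : Matrix m m ℂ, H.PosDef ∧ H - Cᴴ * H * C = Q := by
  obtain ⟨r, hr0, hr1, hr⟩ := exists_eventually_norm_pow_le_of_spectrum_norm_lt_one C hC
  let f : ℕ → Matrix m m ℂ := fun k => (C ^ k)ᴴ * Q * C ^ k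
  have hf : Summable f := by
    have hgeom : Summable fun k : ℕ => ‖Q‖ * (r * r) ^ k :=
      (summable_geometric_of_lt_one (mul_nonneg hr0 hr0) (by nlinarith)).mul_left _
    refine hgeom.of_norm_bounded_eventually_nat ?_
    filter_upwards [hr] with k hk
    calc ‖(C ^ k)ᴴ * Q * C ^ k‖ ≤ ‖(C ^ k)ᴴ‖ * ‖Q‖ * ‖C ^ k‖ := norm_mul₃_le
      _ = ‖Q‖ * (‖C ^ k‖ * ‖C ^ k‖) := by rw [l2_opNorm_conjTranspose]; ring
      _ ≤ ‖Q‖ * (r ^ k * r ^ k) := by gcongr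
      _ = ‖Q‖ * (r * r) ^ k := by rw [mul_pow]
  obtain ⟨H, hH⟩ := hf
  have hstep : H = Q + Cᴴ * H * C := by
    have hshift : HasSum (fun k => f (k + 1)) (Cᴴ * H * C) := by
      have hfk : ∀ k, f (k + 1) = Cᴴ * f k * C := fun k => by
        simp only [f, pow_succ, conjTranspose_mul, Matrix.mul_assoc]
      simpa only [hfk] using (hH.mul_left Cᴴ).mul_right C
    have hzero := hshift.zero_add
    rw [show f 0 = Q by simp [f]] at hzero
    exact hH.unique hzero
  have hpsd : H.PosSemidef :=
    .of_hasSum (fun k => hQ.posSemidef.conjTranspose_mul_mul_same (C ^ k)) hH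
  refine ⟨H, ?_, sub_eq_of_eq_add hstep⟩
  rw [hstep]
  exact hQ.add_posSemidef (hpsd.conjTranspose_mul_mul_same C)

/-- The Cayley transform maps a Hurwitz matrix to a matrix with spectrum in the open unit disc. -/
theorem norm_lt_one_of_mem_spectrum_cayley {S R : Matrix m m ℂ}
    (hS : ∀ lam ∈ spectrum ℂ S, lam.re < 0) (hR : (1 - S) * R = 1) {μ : ℂ}
    (hμ : μ ∈ spectrum ℂ ((1 + S) * R)) : ‖μ‖ < 1 := by
  by_contra! hnorm
  have hunit : IsUnit R := IsUnit.of_mul_eq_one_right _ hR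
  rw [spectrum.mem_iff, Algebra.algebraMap_eq_smul_one] at hμ
  have hfactor : μ • (1 : Matrix m m ℂ) - (1 + S) * R
      = ((μ - 1) • (1 : Matrix m m ℂ) - (μ + 1) • S) * R := by
    have h1 : μ • (1 : Matrix m m ℂ) = (μ • (1 - S)) * R := by rw [smul_mul_assoc, hR]
    rw [h1, ← sub_mul]
    congr 1
    module
  rw [hfactor] at hμ
  refine hμ (IsUnit.mul ?_ hunit)
  by_cases h1 : μ + 1 = 0
  · rw [h1, zero_smul, sub_zero]
    have hne : μ - 1 ≠ 0 := fun h => two_ne_zero (α := ℂ) (by linear_combination h1 - h)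
    exact isUnit_one.smul (Units.mk0 _ hne)
  · have hre : 0 ≤ ((μ - 1) / (μ + 1)).re := by
      have hsq : 1 ≤ μ.re * μ.re + μ.im * μ.im := by
        rw [← Complex.normSq_apply, Complex.normSq_eq_norm_sq]
        nlinarith
      rw [Complex.div_re, ← add_div]
      refine div_nonneg ?_ (Complex.normSq_nonneg _)
      simp
      nlinarith
    have hlam : IsUnit (algebraMap ℂ (Matrix m m ℂ) ((μ - 1) / (μ + 1)) - S) := by
      by_contra h
      exact absurd (hS _ h) (not_lt.2 hre)
    have : (μ - 1) • (1 : Matrix m m ℂ) - (μ + 1) • S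
        = (Units.mk0 _ h1) • (algebraMap ℂ (Matrix m m ℂ) ((μ - 1) / (μ + 1)) - S) := by
      rw [Algebra.algebraMap_eq_smul_one, Units.smul_mk0, smul_sub, smul_smul, mul_div_cancel₀ _ h1]
    rw [this]
    exact hlam.smul _

/-- The Lyapunov equation of a Hurwitz matrix has a positive definite solution. -/
theorem exists_posDef_lyapunov_of_spectrum_re_neg {S Q : Matrix m m ℂ}
    (hS : ∀ lam ∈ spectrum ℂ S, lam.re < 0) (hQ : Q.PosDef) :
    ∃ H : Matrix m m ℂ, H.PosDef ∧ Sᴴ * H + H * S = -Q := by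
  have hunit : IsUnit (1 - S) := by
    by_contra h
    have : (1 : ℂ) ∈ spectrum ℂ S := by rwa [spectrum.mem_iff, map_one]
    exact absurd (hS 1 this) (by norm_num)
  obtain ⟨R, hR, hR'⟩ := isUnit_iff_exists.1 hunit
  have hRunit : IsUnit R := IsUnit.of_mul_eq_one_right _ hR
  have hQR : (Rᴴ * ((2 : ℂ) • Q) * R).PosDef :=
    hRunit.posDef_star_left_conjugate_iff.2 (hQ.smul (by norm_num))
  obtain ⟨H, hH, hstein⟩ := exists_posDef_sub_conjTranspose_mul_mul_eq
    (fun μ => norm_lt_one_of_mem_spectrum_cayley hS hR) hQR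
  refine ⟨H, hH, ?_⟩
  have hRH : (1 - S)ᴴ * Rᴴ = 1 := by rw [← conjTranspose_mul, hR', conjTranspose_one]
  have key : (1 - S)ᴴ * H * (1 - S) - (1 + S)ᴴ * H * (1 + S) = (2 : ℂ) • Q := by
    calc (1 - S)ᴴ * H * (1 - S) - (1 + S)ᴴ * H * (1 + S)
        = (1 - S)ᴴ * H * (1 - S)
            - ((1 - S)ᴴ * Rᴴ) * ((1 + S)ᴴ * H * (1 + S)) * (R * (1 - S)) := by
          rw [hRH, hR', one_mul, mul_one]
      _ = (1 - S)ᴴ * (H - ((1 + S) * R)ᴴ * H * ((1 + S) * R)) * (1 - S) := by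
          rw [conjTranspose_mul (1 + S) R]
          noncomm_ring
      _ = ((1 - S)ᴴ * Rᴴ) * ((2 : ℂ) • Q) * (R * (1 - S)) := by
          rw [hstein]
          noncomm_ring
      _ = (2 : ℂ) • Q := by rw [hRH, hR', one_mul, mul_one]
  have hexpand : (1 - S)ᴴ * H * (1 - S) - (1 + S)ᴴ * H * (1 + S)
      = (2 : ℂ) • -(Sᴴ * H + H * S) := by
    simp only [conjTranspose_sub, conjTranspose_add, conjTranspose_one, two_smul]
    noncomm_ring
  rw [hexpand] at key
  rw [← smul_right_injective _ (two_ne_zero : (2 : ℂ) ≠ 0) key, neg_neg]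

/-- A matrix admitting a positive definite Lyapunov solution for a positive definite right-hand
side is Hurwitz. -/
theorem spectrum_re_neg_of_posDef_lyapunov {S H Q : Matrix m m ℂ} (hH : H.PosDef) (hQ : Q.PosDef)
    (h : Sᴴ * H + H * S = -Q) : ∀ lam ∈ spectrum ℂ S, lam.re < 0 := by
  intro lam hlam
  rw [← spectrum_toLin', ← Module.End.hasEigenvalue_iff_mem_spectrum] at hlam
  obtain ⟨v, hv⟩ := hlam.exists_hasEigenvector
  have hSv : S *ᵥ v = lam • v := by simpa using hv.apply_eq_smul
  have hpos := hH.dotProduct_mulVec_pos hv.2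
  have hQpos := hQ.dotProduct_mulVec_pos hv.2
  have heq : (star lam + lam) * (star v ⬝ᵥ (H *ᵥ v)) = -(star v ⬝ᵥ (Q *ᵥ v)) := by
    rw [← dotProduct_neg, ← neg_mulVec, ← h, add_mulVec, dotProduct_add, ← mulVec_mulVec,
      ← mulVec_mulVec, hSv, dotProduct_mulVec (star v) Sᴴ, ← star_mulVec, hSv, mulVec_smul,
      star_smul, smul_dotProduct, dotProduct_smul, add_mul, smul_eq_mul, smul_eq_mul]
  rw [Complex.pos_iff] at hpos hQpos
  have hre := congrArg Complex.re heq
  simp [← hpos.2] at hre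
  nlinarith [hpos.1, hQpos.1]

end Matrix

/-- A complex matrix `S` is Hurwitz (all eigenvalues have negative real part) iff for every
Hermitian positive definite `Q` there is a Hermitian positive definite `H` with
`Sᴴ H + H S = -Q`. -/
theorem hurwitz_iff_lyapunov
    (n : ℕ) (S : Matrix (Fin n) (Fin n) ℂ) :
    (∀ lam ∈ spectrum ℂ S, lam.re < 0) ↔
      (∀ Q : Matrix (Fin n) (Fin n) ℂ, Q.PosDef →
        ∃ H : Matrix (Fin n) (Fin n) ℂ, H.PosDef ∧ Sᴴ * H + H * S = -Q) := by
  refine ⟨fun hS Q hQ => exists_posDef_lyapunov_of_spectrum_re_neg hS hQ, fun h => ?_⟩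
  obtain ⟨H, hH, hHS⟩ := h 1 .one
  exact spectrum_re_neg_of_posDef_lyapunov hH .one hHS
end

section
/- Let M, N ∈ ℝ^{n×n}, let α⋆ ≥ 0, and let A_e = [[M, −N], [N, M]] ∈ ℝ^{2n×2n}. The spectral abscissa of the complex matrix M + iN is strictly less than −α⋆ if and only if there exist real matrices P = Pᵀ ∈ ℝ^{n×n} and Π = −Πᵀ ∈ ℝ^{n×n} such that P_e := [[P, −Π], [Π, P]] is symmetric positive definite and P_e A_e + A_eᵀ P_e ≺ −2α⋆ P_e (i.e., P_e A_e + A_eᵀ P_e + 2α⋆ P_e is negative definite). -/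
open Matrix

namespace Matrix

open scoped ComplexOrder

variable {m : Type*}

section RealBlock

/-- The real `2n × 2n` block matrix `[[Re Z, -Im Z], [Im Z, Re Z]]` representing a complex
`n × n` matrix `Z`. -/
def realBlock (Z : Matrix m m ℂ) : Matrix (m ⊕ m) (m ⊕ m) ℝ :=
  fromBlocks (Z.map Complex.re) (-(Z.map Complex.im)) (Z.map Complex.im) (Z.map Complex.re)

/-- The real vector `(Re v, Im v)` representing a complex vector `v`. -/
def realVec (v : m → ℂ) : m ⊕ m → ℝ :=
  Sum.elim (fun i => (v i).re) (fun i => (v i).im)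

lemma realVec_surjective : Function.Surjective (realVec (m := m)) := fun x =>
  ⟨fun i => ⟨x (Sum.inl i), x (Sum.inr i)⟩, by ext (i | i) <;> rfl⟩

lemma realVec_eq_zero {v : m → ℂ} : realVec v = 0 ↔ v = 0 := by
  simp [realVec, funext_iff, Complex.ext_iff, forall_and]

lemma realBlock_injective : Function.Injective (realBlock (m := m)) := fun Z W h => by
  ext i j
  have hre := congrFun (congrFun h (Sum.inl i)) (Sum.inl j)
  have him := congrFun (congrFun h (Sum.inr i)) (Sum.inl j)
  exact Complex.ext hre him

lemma realBlock_neg (Z : Matrix m m ℂ) : realBlock (-Z) = -realBlock Z := by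
  ext (i | i) (j | j) <;> simp [realBlock]

lemma realBlock_add (Z W : Matrix m m ℂ) : realBlock (Z + W) = realBlock Z + realBlock W := by
  ext (i | i) (j | j) <;> simp [realBlock, add_comm]

lemma realBlock_smul (r : ℝ) (Z : Matrix m m ℂ) :
    realBlock ((r : ℂ) • Z) = r • realBlock Z := by
  ext (i | i) (j | j) <;> simp [realBlock]

lemma realBlock_conjTranspose (Z : Matrix m m ℂ) : realBlock Zᴴ = (realBlock Z)ᵀ := by
  ext (i | i) (j | j) <;> simp [realBlock]

lemma isHermitian_realBlock_iff {Z : Matrix m m ℂ} :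
    (realBlock Z).IsHermitian ↔ Z.IsHermitian := by
  rw [IsHermitian, IsHermitian, conjTranspose_eq_transpose_of_trivial,
    ← realBlock_conjTranspose, realBlock_injective.eq_iff]

variable [Fintype m]

lemma realBlock_mul (Z W : Matrix m m ℂ) : realBlock (Z * W) = realBlock Z * realBlock W := by
  ext (i | i) (j | j) <;>
    simp [realBlock, mul_apply, Finset.sum_add_distrib, sub_eq_add_neg, add_comm]

lemma realBlock_mulVec (Z : Matrix m m ℂ) (v : m → ℂ) :
    realBlock Z *ᵥ realVec v = realVec (Z *ᵥ v) := by
  ext (i | i) <;>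
    simp [realBlock, realVec, mulVec, dotProduct, Finset.sum_add_distrib, sub_eq_add_neg,
      add_comm]

lemma realVec_dotProduct (v w : m → ℂ) :
    realVec v ⬝ᵥ realVec w = (star v ⬝ᵥ w).re := by
  simp [realVec, dotProduct, Finset.sum_add_distrib]

lemma posDef_realBlock_iff {Z : Matrix m m ℂ} : (realBlock Z).PosDef ↔ Z.PosDef := by
  rw [posDef_iff_dotProduct_mulVec, posDef_iff_dotProduct_mulVec, isHermitian_realBlock_iff]
  refine and_congr_right fun hZ => ?_
  refine realVec_surjective.forall.trans (forall_congr' fun v => ?_)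
  rw [Ne, realVec_eq_zero, star_trivial, realBlock_mulVec, realVec_dotProduct, Complex.lt_def]
  exact imp_congr_right fun _ =>
    (and_iff_left (hZ.im_star_dotProduct_mulVec_self v).symm).symm

end RealBlock

variable [Fintype m] [DecidableEq m]

lemma mem_spectrum_iff_exists_mulVec {K : Type*} [Field K] {A : Matrix m m K} {μ : K} :
    μ ∈ spectrum K A ↔ ∃ v, v ≠ 0 ∧ A *ᵥ v = μ • v := by
  rw [spectrum.mem_iff, isUnit_iff_isUnit_det, isUnit_iff_ne_zero, not_not,
    ← exists_mulVec_eq_zero_iff]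
  simp [sub_mulVec, sub_eq_zero, eq_comm, Algebra.algebraMap_eq_smul_one, smul_mulVec]

section Norm

open scoped Matrix.Norms.L2Operator

lemma posDef_one_sub_conjTranspose_mul_self {C : Matrix m m ℂ} (hC : ‖C‖ < 1) :
    (1 - Cᴴ * C).PosDef := by
  refine .of_dotProduct_mulVec_pos
    (isHermitian_one.sub (isHermitian_conjTranspose_mul_self C)) fun x hx => ?_
  have key (y : m → ℂ) : star y ⬝ᵥ y = ((‖WithLp.toLp 2 y‖ ^ 2 : ℝ) : ℂ) := by
    rw [dotProduct_comm, ← EuclideanSpace.inner_toLp_toLp, inner_self_eq_norm_sq_to_K]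
    simp
  have hpos : 0 < ‖WithLp.toLp 2 x‖ := by simpa using hx
  have hle : ‖WithLp.toLp 2 (C *ᵥ x)‖ ≤ ‖C‖ * ‖WithLp.toLp 2 x‖ :=
    l2_opNorm_mulVec C (WithLp.toLp 2 x)
  have hlt : ‖WithLp.toLp 2 (C *ᵥ x)‖ < ‖WithLp.toLp 2 x‖ :=
    hle.trans_lt (mul_lt_of_lt_one_left hpos hC)
  rw [sub_mulVec, one_mulVec, dotProduct_sub, ← mulVec_mulVec, dotProduct_mulVec,
    ← star_mulVec, key, key, sub_pos, Complex.real_lt_real]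
  gcongr

lemma exists_norm_pow_lt_one [Nonempty m] {B : Matrix m m ℂ}
    (hB : ∀ μ ∈ spectrum ℂ B, ‖μ‖ < 1) : ∃ k, 0 < k ∧ ‖B ^ k‖ < 1 := by
  have hr : spectralRadius ℂ B < 1 := by
    exact_mod_cast spectrum.spectralRadius_lt_of_forall_lt B (r := 1) fun z hz => hB z hz
  obtain ⟨k, hk, hk0⟩ :=
    (((spectrum.pow_nnnorm_pow_one_div_tendsto_nhds_spectralRadius B).eventually_lt_const hr).and
      (Filter.eventually_gt_atTop 0)).exists
  refine ⟨k, hk0, ?_⟩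
  contrapose! hk
  exact ENNReal.one_le_rpow (by exact_mod_cast hk) (by positivity)

end Norm

/-- **Stein's theorem**: a matrix with spectrum in the open unit disc admits a discrete-time
quadratic Lyapunov function. -/
lemma exists_posDef_sub_conjTranspose_mul_mul {B : Matrix m m ℂ}
    (hB : ∀ μ ∈ spectrum ℂ B, ‖μ‖ < 1) :
    ∃ H : Matrix m m ℂ, H.PosDef ∧ (H - Bᴴ * H * B).PosDef := by
  cases isEmpty_or_nonempty m
  · exact ⟨1, .one, by
      rw [Subsingleton.elim (1 - Bᴴ * 1 * B) 1]
      exact .one⟩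
  obtain ⟨k, hk, hlt⟩ := exists_norm_pow_lt_one hB
  obtain ⟨k, rfl⟩ := Nat.exists_eq_add_one.mpr hk
  refine ⟨∑ j ∈ Finset.range (k + 1), (B ^ j)ᴴ * B ^ j, ?_, ?_⟩
  · rw [Finset.sum_range_succ']
    refine PosDef.posSemidef_add
      (posSemidef_sum _ fun _ _ => posSemidef_conjTranspose_mul_self _) ?_
    simpa using PosDef.one (n := m) (R := ℂ)
  · convert posDef_one_sub_conjTranspose_mul_self hlt using 1
    have hstep (j : ℕ) : Bᴴ * ((B ^ j)ᴴ * B ^ j) * B = (B ^ (j + 1))ᴴ * B ^ (j + 1) := by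
      rw [pow_succ, conjTranspose_mul]
      simp only [Matrix.mul_assoc]
    rw [Finset.mul_sum, Finset.sum_mul, ← Finset.sum_sub_distrib]
    simp only [hstep]
    rw [Finset.sum_range_sub' (fun j => (B ^ j)ᴴ * B ^ j)]
    simp

/-- **Lyapunov's theorem**, existence part. -/
lemma exists_posDef_lyapunov {A : Matrix m m ℂ} (hA : ∀ μ ∈ spectrum ℂ A, μ.re < 0) :
    ∃ H : Matrix m m ℂ, H.PosDef ∧ (-(H * A + Aᴴ * H)).PosDef := by
  have hD : IsUnit (A - 1) := by
    have h1 : (1 : ℂ) ∉ spectrum ℂ A := fun h => by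
      have := hA 1 h
      norm_num at this
    rw [spectrum.notMem_iff, map_one] at h1
    simpa using h1.neg
  have hdet : IsUnit (A - 1).det := (isUnit_iff_isUnit_det _).mp hD
  have hB : ∀ μ ∈ spectrum ℂ ((A + 1) * (A - 1)⁻¹), ‖μ‖ < 1 := by
    intro μ hμ
    obtain ⟨v, hv, h⟩ := mem_spectrum_iff_exists_mulVec.mp hμ
    obtain ⟨w, rfl⟩ : ∃ w, (A - 1) *ᵥ w = v :=
      ⟨(A - 1)⁻¹ *ᵥ v, by rw [mulVec_mulVec, mul_nonsing_inv _ hdet, one_mulVec]⟩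
    have hw : w ≠ 0 := by
      rintro rfl
      simp at hv
    rw [mulVec_mulVec, Matrix.mul_assoc, nonsing_inv_mul _ hdet, Matrix.mul_one, add_mulVec,
      sub_mulVec, one_mulVec, smul_sub] at h
    have h' : (μ - 1) • (A *ᵥ w) = (μ + 1) • w := by
      rw [sub_smul, add_smul, one_smul, one_smul]
      linear_combination -h
    have hμ1 : μ - 1 ≠ 0 := by
      intro h0
      rw [h0, zero_smul, sub_eq_zero.mp h0] at h'
      rcases smul_eq_zero.mp h'.symm with h2 | h2
      · norm_num at h2
      · exact hw h2
    have hmem : (μ + 1) / (μ - 1) ∈ spectrum ℂ A := by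
      refine mem_spectrum_iff_exists_mulVec.mpr ⟨w, hw, ?_⟩
      rw [div_eq_inv_mul, mul_smul, ← h', inv_smul_smul₀ hμ1]
    have hre := hA _ hmem
    have hn : 0 < Complex.normSq (μ - 1) := Complex.normSq_pos.mpr hμ1
    rw [Complex.div_re, ← add_div, div_lt_iff₀ hn, zero_mul] at hre
    have hsq : ‖μ‖ ^ 2 < 1 := by
      rw [Complex.sq_norm, Complex.normSq_apply]
      simp at hre
      linarith
    exact (sq_lt_one_iff₀ (norm_nonneg _)).mp hsq
  obtain ⟨H, hH, hS⟩ := exists_posDef_sub_conjTranspose_mul_mul hB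
  refine ⟨H + H, hH.add hH, ?_⟩
  convert hS.conjTranspose_mul_mul_same (mulVec_injective_of_isUnit hD) using 1
  have hBD : (A + 1) * (A - 1)⁻¹ * (A - 1) = A + 1 := by
    rw [Matrix.mul_assoc, nonsing_inv_mul _ hdet, Matrix.mul_one]
  have hDB : (A - 1)ᴴ * ((A + 1) * (A - 1)⁻¹)ᴴ = (A + 1)ᴴ := by
    rw [← conjTranspose_mul, hBD]
  calc -((H + H) * A + Aᴴ * (H + H))
      = (A - 1)ᴴ * H * (A - 1) - (A + 1)ᴴ * H * (A + 1) := by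
        simp only [conjTranspose_sub, conjTranspose_add, conjTranspose_one]
        noncomm_ring
    _ = (A - 1)ᴴ * H * (A - 1) - (A - 1)ᴴ * ((A + 1) * (A - 1)⁻¹)ᴴ * H *
          ((A + 1) * (A - 1)⁻¹ * (A - 1)) := by rw [hBD, hDB]
    _ = _ := by noncomm_ring

/-- **Lyapunov's theorem**: the spectrum of `A` lies in the half plane `Re z < -α` iff `A` admits
a quadratic Lyapunov function with decay rate `α`. -/
theorem forall_spectrum_re_lt_iff_exists_posDef {A : Matrix m m ℂ} {α : ℝ} :
    (∀ μ ∈ spectrum ℂ A, μ.re < -α) ↔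
      ∃ H : Matrix m m ℂ, H.PosDef ∧
        (-(H * A + Aᴴ * H + ((2 * α : ℝ) : ℂ) • H)).PosDef := by
  constructor
  · intro h
    obtain ⟨H, hH, hL⟩ := exists_posDef_lyapunov (A := A + (α : ℂ) • 1) fun μ hμ => by
      obtain ⟨v, hv, hv'⟩ := mem_spectrum_iff_exists_mulVec.mp hμ
      have hmem : μ - α ∈ spectrum ℂ A := by
        refine mem_spectrum_iff_exists_mulVec.mpr ⟨v, hv, ?_⟩
        rw [sub_smul, ← hv', add_mulVec, smul_mulVec, one_mulVec, add_sub_cancel_right]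
      have := h _ hmem
      simp at this
      linarith
    refine ⟨H, hH, ?_⟩
    convert hL using 2
    simp only [conjTranspose_add, conjTranspose_smul, conjTranspose_one, mul_add, add_mul,
      mul_smul_comm, smul_mul_assoc, mul_one, one_mul, Complex.star_def, Complex.conj_ofReal]
    push_cast
    module
  · rintro ⟨H, hH, hL⟩ μ hμ
    obtain ⟨v, hv, hv'⟩ := mem_spectrum_iff_exists_mulVec.mp hμ
    have h1 := hH.dotProduct_mulVec_pos hv
    have h2 := hL.dotProduct_mulVec_pos hv
    have hstar : star v ⬝ᵥ (Aᴴ * H) *ᵥ v = star μ * (star v ⬝ᵥ H *ᵥ v) := by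
      rw [← mulVec_mulVec, dotProduct_mulVec, ← star_mulVec, hv', star_smul, smul_dotProduct,
        smul_eq_mul]
    have hexp : star v ⬝ᵥ (-(H * A + Aᴴ * H + ((2 * α : ℝ) : ℂ) • H)) *ᵥ v =
        ((-2 * (μ.re + α) : ℝ) : ℂ) * (star v ⬝ᵥ H *ᵥ v) := by
      rw [neg_mulVec, add_mulVec, add_mulVec, dotProduct_neg, dotProduct_add, dotProduct_add,
        hstar, ← mulVec_mulVec, hv', mulVec_smul, dotProduct_smul, smul_mulVec, dotProduct_smul]
      have := Complex.add_conj μ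
      simp only [smul_eq_mul, Complex.star_def]
      push_cast at this ⊢
      linear_combination (-(star v ⬝ᵥ H *ᵥ v)) * this
    rw [hexp] at h2
    have h3 := (Complex.lt_def.mp h2).1
    have h4 := (Complex.lt_def.mp h1).1
    rw [Complex.re_ofReal_mul] at h3
    have := pos_of_mul_pos_left h3 h4.le
    linarith

/-- The complex Lyapunov characterization in terms of real block matrices. -/
theorem forall_spectrum_re_lt_iff_exists_posDef_realBlock {A : Matrix m m ℂ} {α : ℝ} :
    (∀ μ ∈ spectrum ℂ A, μ.re < -α) ↔
      ∃ H : Matrix m m ℂ, (realBlock H).PosDef ∧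
        (-(realBlock H * realBlock A + (realBlock A)ᵀ * realBlock H +
          (2 * α) • realBlock H)).PosDef := by
  simp only [forall_spectrum_re_lt_iff_exists_posDef, ← realBlock_conjTranspose, ← realBlock_mul,
    ← realBlock_add, ← realBlock_smul, ← realBlock_neg, posDef_realBlock_iff]

end Matrix

/-- Continuous-time Lyapunov characterization: the spectral abscissa of `M + iN` is
less than `-α⋆` iff there are `P = Pᵀ` and `Π = -Πᵀ` with
`P_e = [[P, -Π], [Π, P]] ≻ 0` and `P_e A_e + A_eᵀ P_e ≺ -2α⋆ P_e`,
where `A_e = [[M, -N], [N, M]]`. -/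
theorem spectral_abscissa_lt_iff_lyapunov
    (n : ℕ) (M N : Matrix (Fin n) (Fin n) ℝ) (αs : ℝ) (hαs : 0 ≤ αs)
    (Ae : Matrix (Fin n ⊕ Fin n) (Fin n ⊕ Fin n) ℝ)
    (hAe : Ae = Matrix.fromBlocks M (-N) N M) :
    (∀ lam ∈ spectrum ℂ
        (M.map (Complex.ofReal) + Complex.I • N.map (Complex.ofReal)),
      lam.re < -αs) ↔
      ∃ (P Pi : Matrix (Fin n) (Fin n) ℝ), Pᵀ = P ∧ Piᵀ = -Pi ∧
        (Matrix.fromBlocks P (-Pi) Pi P).PosDef ∧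
        (-(Matrix.fromBlocks P (-Pi) Pi P * Ae + Aeᵀ * Matrix.fromBlocks P (-Pi) Pi P
            + (2 * αs) • Matrix.fromBlocks P (-Pi) Pi P)).PosDef := by
  have hAe' : Ae = realBlock (M.map Complex.ofReal + Complex.I • N.map Complex.ofReal) := by
    rw [hAe]
    ext (i | i) (j | j) <;> simp [realBlock]
  rw [forall_spectrum_re_lt_iff_exists_posDef_realBlock, ← hAe']
  constructor
  · rintro ⟨H, hH, hL⟩
    have hHerm := isHermitian_realBlock_iff.mp hH.isHermitian
    refine ⟨H.map Complex.re, H.map Complex.im, ?_, ?_, hH, hL⟩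
    · ext i j
      simpa using congrArg Complex.re (hHerm.apply i j)
    · ext i j
      simpa [neg_eq_iff_eq_neg] using congrArg Complex.im (hHerm.apply i j)
  · rintro ⟨P, Pi, -, -, hP, hL⟩
    have hH : fromBlocks P (-Pi) Pi P =
        realBlock (P.map Complex.ofReal + Complex.I • Pi.map Complex.ofReal) := by
      ext (i | i) (j | j) <;> simp [realBlock]
    rw [hH] at hP hL
    exact ⟨_, hP, hL⟩
end

section
/- Suppose that for every reduced Laplacian eigenvalue λ the spectral abscissa of A − λBC is strictly less than −α⋆, where α⋆ ≥ 0. Then there exist α > α⋆, constants c₁, c₂ > 0, and a symmetric positive semidefinite matrix 𝑃 ∈ ℝ^{Nn×Nn} such that c₁ ΨᵀΨ ⪯ 𝑃 ⪯ c₂ ΨᵀΨ and 𝐀ᵀ𝑃 + 𝑃𝐀 ⪯ −2α𝑃 (so V(x) = xᵀ𝑃x is a strict quadratic Lyapunov function for the synchronization set, satisfying c₁‖Ψx‖² ≤ V(x) ≤ c₂‖Ψx‖² and V̇(x) ≤ −2αV(x) along solutions of ẋ = 𝐀x). -/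
open Matrix Polynomial
open scoped Kronecker

theorem Matrix.mem_spectrum_iff_exists_mulVec_eq_smul {ι K : Type*} [Fintype ι] [DecidableEq ι]
    [Field K] (M : Matrix ι ι K) (μ : K) :
    μ ∈ spectrum K M ↔ ∃ v ≠ 0, M *ᵥ v = μ • v := by
  rw [spectrum.mem_iff, Matrix.isUnit_iff_isUnit_det, isUnit_iff_ne_zero, not_not,
    ← Matrix.exists_mulVec_eq_zero_iff]
  refine exists_congr fun v => and_congr_right fun _ => ?_
  rw [Matrix.sub_mulVec, sub_eq_zero, Algebra.algebraMap_eq_smul_one, Matrix.smul_mulVec,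
    Matrix.one_mulVec, eq_comm]

theorem Matrix.charpoly_mul_charpoly_of_mul_eq_zero {ι R : Type*} [Fintype ι] [DecidableEq ι]
    [CommRing R] {G H : Matrix ι ι R} (h : G * H = 0) :
    G.charpoly * H.charpoly = X ^ Fintype.card ι * (G + H).charpoly := by
  have hmap : (Polynomial.C.mapMatrix G : Matrix ι ι R[X]) * Polynomial.C.mapMatrix H = 0 := by
    rw [← map_mul, h, map_zero]
  rw [Matrix.charpoly, Matrix.charpoly, Matrix.charpoly, ← Matrix.det_mul, ← Matrix.det_smul]
  congr 1
  simp only [charmatrix, map_add, sub_mul, mul_sub, hmap]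
  have hc : ∀ Y : Matrix ι ι R[X], Y * Matrix.scalar ι X = (X : R[X]) • Y := fun Y => by
    rw [Matrix.smul_eq_mul_diagonal]; rfl
  have hc' : ∀ Y : Matrix ι ι R[X], Matrix.scalar ι X * Y = (X : R[X]) • Y := fun Y => by
    rw [Matrix.smul_eq_diagonal_mul]; rfl
  rw [hc, hc, hc', smul_sub, smul_add]
  abel

/-- A nonzero vector with vanishing average which is an eigenvector of `(1 - J) L`
yields a reduced eigenvalue of `L`. -/
theorem isRoot_charpoly_div_X {ι K : Type*} [Fintype ι] [DecidableEq ι] [Nonempty ι]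
    [Field K] [CharZero K] {L J : Matrix ι ι K}
    (hJ : J = (Fintype.card ι : K)⁻¹ • Matrix.of fun _ _ => 1) (hLJ : L * J = 0)
    {lam : K} {w : ι → K} (hw : w ≠ 0) (hJw : J *ᵥ w = 0)
    (hLw : ((1 - J) * L) *ᵥ w = lam • w) :
    (L.charpoly / X).IsRoot lam := by
  have hcard : (Fintype.card ι : K) ≠ 0 := Nat.cast_ne_zero.2 Fintype.card_ne_zero
  set s : K := 1 - lam with hs
  have hvec : -(s • J) = Matrix.vecMulVec (fun _ => -s * (Fintype.card ι : K)⁻¹) (fun _ => 1) := by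
    ext i j
    simp [hJ, Matrix.vecMulVec_apply]
  have hHchar : (-(s • J)).charpoly = X ^ (Fintype.card ι - 1) * (X + C s) := by
    rw [hvec, Matrix.charpoly_vecMulVec]
    have : (fun _ : ι => -s * (Fintype.card ι : K)⁻¹) ⬝ᵥ (fun _ => 1) = -s := by
      simp [dotProduct]
      field_simp
    rw [this]
    obtain ⟨k, hk⟩ : ∃ k, Fintype.card ι = k + 1 := ⟨_, (Nat.succ_pred Fintype.card_ne_zero).symm⟩
    rw [hk, smul_eq_C_mul]
    simp only [Nat.add_sub_cancel, C_neg]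
    ring
  have hGchar : ((1 - J) * L).charpoly = L.charpoly := by
    rw [Matrix.charpoly_mul_comm, mul_sub, hLJ, mul_one, sub_zero]
  have hprod : ((1 - J) * L) * (-(s • J)) = 0 := by
    rw [mul_neg, Matrix.mul_smul, mul_assoc, hLJ]; simp
  have hX : X ∣ L.charpoly := by
    have : (0 : K) ∈ spectrum K L := by
      rw [Matrix.mem_spectrum_iff_exists_mulVec_eq_smul]
      refine ⟨J *ᵥ fun _ => 1, ?_, by simp [Matrix.mulVec_mulVec, hLJ]⟩
      intro h0
      have := congrFun h0 (Classical.arbitrary ι)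
      simp [hJ, Matrix.mulVec, dotProduct] at this
    rw [Matrix.mem_spectrum_iff_isRoot_charpoly] at this
    rwa [X_dvd_iff, coeff_zero_eq_eval_zero]
  obtain ⟨q, hq⟩ := hX
  have hdiv : L.charpoly / X = q := by
    rw [hq, mul_div_cancel_left₀ _ X_ne_zero]
  have key := Matrix.charpoly_mul_charpoly_of_mul_eq_zero hprod
  rw [hGchar, hHchar, hq] at key
  have key' : q * (X + C s) = ((1 - J) * L + -(s • J)).charpoly := by
    refine mul_left_cancel₀ (pow_ne_zero (Fintype.card ι) (X_ne_zero (R := K))) ?_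
    rw [← key]
    obtain ⟨k, hk⟩ : ∃ k, Fintype.card ι = k + 1 := ⟨_, (Nat.succ_pred Fintype.card_ne_zero).symm⟩
    rw [hk]
    simp only [Nat.add_sub_cancel]
    ring
  have hroot : ((1 - J) * L + -(s • J)).charpoly.IsRoot lam := by
    rw [← Matrix.mem_spectrum_iff_isRoot_charpoly, Matrix.mem_spectrum_iff_exists_mulVec_eq_smul]
    exact ⟨w, hw, by
      rw [Matrix.add_mulVec, hLw, Matrix.neg_mulVec, Matrix.smul_mulVec, hJw]; simp⟩
  rw [← key', IsRoot, eval_mul] at hroot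
  rw [hdiv]
  simpa [hs] using hroot

/-- Commuting operators share an eigenvector inside any nonzero eigenspace. -/
theorem Matrix.exists_common_eigenvector {ι K : Type*} [Fintype ι] [DecidableEq ι] [Field K]
    [IsAlgClosed K] {F M : Matrix ι ι K} (h : F * M = M * F) {μ : K} {v : ι → K} (hv : v ≠ 0)
    (hMv : M *ᵥ v = μ • v) :
    ∃ lam : K, ∃ w ≠ 0, F *ᵥ w = lam • w ∧ M *ᵥ w = μ • w := by
  have hmem : ∀ x, x ∈ Module.End.eigenspace (Matrix.toLin' M) μ ↔ M *ᵥ x = μ • x := fun x => by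
    rw [Module.End.mem_eigenspace_iff, Matrix.toLin'_apply]
  have hmap : ∀ x ∈ Module.End.eigenspace (Matrix.toLin' M) μ,
      Matrix.toLin' F x ∈ Module.End.eigenspace (Matrix.toLin' M) μ := fun x hx => by
    rw [hmem] at hx ⊢
    rw [Matrix.toLin'_apply, Matrix.mulVec_mulVec, ← h, ← Matrix.mulVec_mulVec, hx,
      Matrix.mulVec_smul]
  have : Nontrivial (Module.End.eigenspace (Matrix.toLin' M) μ) :=
    ⟨⟨⟨v, (hmem v).2 hMv⟩, 0, fun h0 => hv (congrArg Subtype.val h0)⟩⟩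
  obtain ⟨lam, hlam⟩ := Module.End.exists_eigenvalue ((Matrix.toLin' F).restrict hmap)
  obtain ⟨w, hw⟩ := hlam.exists_hasEigenvector
  refine ⟨lam, w, fun h0 => hw.2 (Subtype.ext h0), ?_, (hmem w).1 w.2⟩
  simpa using congrArg Subtype.val hw.apply_eq_smul

theorem Matrix.one_kronecker_mulVec_apply {ι κ R : Type*} [Fintype ι] [Fintype κ] [DecidableEq ι]
    [CommSemiring R] (A : Matrix κ κ R) (v : ι × κ → R) (i : ι) (k : κ) :
    (((1 : Matrix ι ι R) ⊗ₖ A) *ᵥ v) (i, k) = (A *ᵥ fun l => v (i, l)) k := by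
  simp [Matrix.mulVec, dotProduct, Fintype.sum_prod_type, Matrix.one_apply, ite_mul,
    Finset.sum_ite_irrel]

theorem Matrix.kronecker_one_mulVec_apply {ι κ R : Type*} [Fintype ι] [Fintype κ] [DecidableEq κ]
    [CommSemiring R] (G : Matrix ι ι R) (v : ι × κ → R) (i : ι) (k : κ) :
    ((G ⊗ₖ (1 : Matrix κ κ R)) *ᵥ v) (i, k) = (G *ᵥ fun j => v (j, k)) i := by
  simp [Matrix.mulVec, dotProduct, Fintype.sum_prod_type, Matrix.one_apply]

/-- The eigenvalues of the closed loop on the disagreement subspace, completed by `-s` on the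
synchronization subspace. -/
theorem spectrum_disagreement {ι κ K : Type*} [Fintype ι] [DecidableEq ι] [Nonempty ι]
    [Fintype κ] [DecidableEq κ] [Field K] [CharZero K] [IsAlgClosed K]
    {L J : Matrix ι ι K} (hJ : J = (Fintype.card ι : K)⁻¹ • Matrix.of fun _ _ => 1)
    (hLJ : L * J = 0) (A E : Matrix κ κ K) (s : K) {μ : K}
    (hμ : μ ∈ spectrum K ((1 - J) ⊗ₖ A - ((1 - J) * L) ⊗ₖ E - s • (J ⊗ₖ (1 : Matrix κ κ K)))) :
    μ = -s ∨ ∃ lam, (L.charpoly / X).IsRoot lam ∧ μ ∈ spectrum K (A - lam • E) := by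
  have hJJ : J * J = J := by
    ext i j
    simp [hJ, Matrix.mul_apply]
  have hJP : J * (1 - J) = 0 := by rw [mul_sub, hJJ, mul_one, sub_self]
  have hPJ : (1 - J) * J = 0 := by rw [sub_mul, hJJ, one_mul, sub_self]
  have hPP : (1 - J) * (1 - J) = 1 - J := by rw [mul_sub, hPJ, mul_one, sub_zero]
  have hLP : L * (1 - J) = L := by rw [mul_sub, hLJ, mul_one, sub_zero]
  set G := (1 - J) * L with hG
  have hGP : G * (1 - J) = G := by rw [hG, mul_assoc, hLP]
  have hPG : (1 - J) * G = G := by rw [hG, ← mul_assoc, hPP]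
  have hGJ : G * J = 0 := by rw [hG, mul_assoc, hLJ, mul_zero]
  have hJG : J * G = 0 := by rw [hG, ← mul_assoc, hJP, zero_mul]
  set M := (1 - J) ⊗ₖ A - G ⊗ₖ E - s • (J ⊗ₖ (1 : Matrix κ κ K)) with hM
  have hcomm : (G ⊗ₖ (1 : Matrix κ κ K)) * M = M * (G ⊗ₖ (1 : Matrix κ κ K)) := by
    simp only [hM, mul_sub, sub_mul, Matrix.mul_smul, Matrix.smul_mul, ← Matrix.mul_kronecker_mul,
      one_mul, mul_one, hGJ, hJG, hGP, hPG]
  obtain ⟨v, hv, hMv⟩ := (Matrix.mem_spectrum_iff_exists_mulVec_eq_smul _ _).1 hμ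
  obtain ⟨lam, w, hw, hGw, hMw⟩ := Matrix.exists_common_eigenvector hcomm hv hMv
  by_cases hμs : μ = -s
  · exact Or.inl hμs
  have hJM : (J ⊗ₖ (1 : Matrix κ κ K)) * M = -s • (J ⊗ₖ (1 : Matrix κ κ K)) := by
    rw [hM, mul_sub, mul_sub, Matrix.mul_smul]
    simp only [← Matrix.mul_kronecker_mul, hJP, hJG, hJJ]
    simp
  have hJw : (J ⊗ₖ (1 : Matrix κ κ K)) *ᵥ w = 0 := by
    have h1 : (-s) • ((J ⊗ₖ (1 : Matrix κ κ K)) *ᵥ w)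
        = μ • ((J ⊗ₖ (1 : Matrix κ κ K)) *ᵥ w) := by
      rw [← Matrix.smul_mulVec, ← hJM, ← Matrix.mulVec_mulVec, hMw, Matrix.mulVec_smul]
    rw [← sub_eq_zero, ← sub_smul] at h1
    exact (smul_eq_zero.1 h1).resolve_left fun h => hμs (sub_eq_zero.1 h).symm
  have hMw' : ((1 : Matrix ι ι K) ⊗ₖ (A - lam • E)) *ᵥ w = μ • w := by
    have h1 : M = ((1 : Matrix ι ι K) ⊗ₖ A) * (1 - J ⊗ₖ (1 : Matrix κ κ K))
        - ((1 : Matrix ι ι K) ⊗ₖ E) * (G ⊗ₖ (1 : Matrix κ κ K))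
        - s • (J ⊗ₖ (1 : Matrix κ κ K)) := by
      have h2 : (1 : Matrix ι ι K) ⊗ₖ A = (1 - J) ⊗ₖ A + J ⊗ₖ A := by
        rw [← Matrix.add_kronecker, sub_add_cancel]
      rw [mul_sub, mul_one, ← Matrix.mul_kronecker_mul, ← Matrix.mul_kronecker_mul, one_mul,
        one_mul, mul_one, mul_one, hM, h2, add_sub_cancel_right]
    have h3 : (1 : Matrix ι ι K) ⊗ₖ (A - lam • E)
        = (1 : Matrix ι ι K) ⊗ₖ A - lam • ((1 : Matrix ι ι K) ⊗ₖ E) := by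
      rw [← Matrix.kronecker_smul, eq_sub_iff_add_eq, ← Matrix.kronecker_add, sub_add_cancel]
    rw [← hMw, h1, h3, Matrix.sub_mulVec, Matrix.sub_mulVec, Matrix.sub_mulVec, ← Matrix.mulVec_mulVec,
      ← Matrix.mulVec_mulVec, Matrix.smul_mulVec, Matrix.smul_mulVec, Matrix.sub_mulVec,
      hJw, hGw, Matrix.mulVec_smul]
    simp
  obtain ⟨⟨i, k⟩, hik⟩ := Function.ne_iff.1 hw
  refine Or.inr ⟨lam, ?_, ?_⟩
  · refine isRoot_charpoly_div_X hJ hLJ (w := fun j => w (j, k)) (Function.ne_iff.2 ⟨i, hik⟩) ?_ ?_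
    · funext j
      rw [← Matrix.kronecker_one_mulVec_apply, hJw]; rfl
    · funext j
      rw [← Matrix.kronecker_one_mulVec_apply, hGw]; rfl
  · rw [Matrix.mem_spectrum_iff_exists_mulVec_eq_smul]
    refine ⟨fun l => w (i, l), Function.ne_iff.2 ⟨k, hik⟩, ?_⟩
    funext l
    rw [← Matrix.one_kronecker_mulVec_apply, hMw']; rfl

section L2
open scoped Matrix.Norms.L2Operator ENNReal NNReal

theorem Matrix.exists_pow_norm_le_one {ι : Type*} [Fintype ι] [DecidableEq ι]
    (Q : Matrix ι ι ℂ) (hQ : ∀ ν ∈ spectrum ℂ Q, ‖ν‖ < 1) : ∃ m : ℕ, 1 ≤ m ∧ ‖Q ^ m‖ ≤ 1 := by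
  cases isEmpty_or_nonempty ι
  · exact ⟨1, le_rfl, by rw [Subsingleton.elim (Q ^ 1) 0]; simp⟩
  have hr : spectralRadius ℂ Q < (1 : ℝ≥0) :=
    spectrum.spectralRadius_lt_of_forall_lt Q fun ν hν => by
      rw [← NNReal.coe_lt_coe]; simpa using hQ ν hν
  have hlim := spectrum.pow_nnnorm_pow_one_div_tendsto_nhds_spectralRadius Q
  obtain ⟨m, hm, hm1⟩ :=
    ((hlim.eventually_lt_const hr).and (Filter.eventually_ge_atTop 1)).exists
  refine ⟨m, hm1, ?_⟩
  have hpos : (0 : ℝ) < 1 / (m : ℝ) := by positivity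
  by_contra! hlt
  refine absurd hm (not_lt.2 ?_)
  have : (1 : ℝ≥0∞) ≤ (‖Q ^ m‖₊ : ℝ≥0∞) := by
    rw [ENNReal.one_le_coe_iff]
    exact hlt.le
  simpa using ENNReal.one_le_rpow this hpos

theorem Matrix.posSemidef_one_sub_transpose_mul_self {ι : Type*} [Fintype ι] [DecidableEq ι]
    (T : Matrix ι ι ℝ) (hT : ‖T.map Complex.ofReal‖ ≤ 1) : (1 - Tᵀ * T).PosSemidef := by
  refine PosSemidef.of_dotProduct_mulVec_nonneg ?_ fun x => ?_
  · simp [IsHermitian, conjTranspose_eq_transpose_of_trivial]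
  · have hsq : ∀ y : ι → ℝ, ‖WithLp.toLp 2 fun i => (y i : ℂ)‖ ^ 2 = y ⬝ᵥ y := fun y => by
      rw [EuclideanSpace.norm_sq_eq]
      simp [dotProduct, pow_two]
    have hmul : (T.map Complex.ofReal) *ᵥ (fun i => (x i : ℂ)) = fun i => ((T *ᵥ x) i : ℂ) := by
      funext i
      simp [Matrix.mulVec, dotProduct]
    have h := Matrix.l2_opNorm_mulVec (T.map Complex.ofReal) (WithLp.toLp 2 fun i => (x i : ℂ))
    have h2 : (T *ᵥ x) ⬝ᵥ (T *ᵥ x) ≤ x ⬝ᵥ x := by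
      rw [← hsq, ← hsq]
      refine pow_le_pow_left₀ (norm_nonneg _) ?_ 2
      rw [← hmul]
      exact h.trans (mul_le_of_le_one_left (norm_nonneg _) hT)
    rw [Matrix.sub_mulVec, Matrix.one_mulVec, dotProduct_sub, star_trivial,
      ← Matrix.mulVec_mulVec, Matrix.dotProduct_mulVec, Matrix.vecMul_transpose]
    exact sub_nonneg.2 h2

theorem Matrix.exists_posSemidef_smul_one_sub {ι : Type*} [Fintype ι] [DecidableEq ι]
    {P : Matrix ι ι ℝ} (hP : P.IsHermitian) :
    ∃ c > (0 : ℝ), (c • (1 : Matrix ι ι ℝ) - P).PosSemidef := by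
  refine ⟨‖P‖ + 1, by positivity, PosSemidef.of_dotProduct_mulVec_nonneg ?_ fun x => ?_⟩
  · exact (isHermitian_one.smul (by simp [IsSelfAdjoint])).sub hP
  · have h := Matrix.l2_opNorm_mulVec P (WithLp.toLp 2 x)
    have h1 : x ⬝ᵥ (P *ᵥ x) ≤ ‖WithLp.toLp 2 x‖ * ‖WithLp.toLp 2 (P *ᵥ x)‖ := by
      have := real_inner_le_norm (WithLp.toLp 2 x) (WithLp.toLp 2 (P *ᵥ x))
      simpa [EuclideanSpace.inner_eq_star_dotProduct, dotProduct_comm] using this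
    have h2 : x ⬝ᵥ x = ‖WithLp.toLp 2 x‖ ^ 2 := by
      rw [EuclideanSpace.norm_sq_eq]
      simp [dotProduct, pow_two]
    have h3 : ‖WithLp.toLp 2 (P *ᵥ x)‖ ≤ ‖P‖ * ‖WithLp.toLp 2 x‖ := h
    rw [Matrix.sub_mulVec, Matrix.smul_mulVec, Matrix.one_mulVec, dotProduct_sub, star_trivial,
      dotProduct_smul, h2, smul_eq_mul]
    nlinarith [norm_nonneg (WithLp.toLp 2 x), mul_le_mul_of_nonneg_left h3
      (norm_nonneg (WithLp.toLp 2 x)), sq_nonneg ‖WithLp.toLp 2 x‖]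

end L2

theorem Complex.norm_lt_one_of_re_cayley_neg {ν : ℂ} (hν : ν + 1 ≠ 0)
    (h : ((ν - 1) / (ν + 1)).re < 0) : ‖ν‖ < 1 := by
  have hpos : 0 < Complex.normSq (ν + 1) := Complex.normSq_pos.2 hν
  rw [Complex.div_re, ← add_div, div_neg_iff] at h
  have h1 := (h.resolve_left fun h' => absurd h'.2 hpos.le.not_gt).1
  simp at h1
  have h2 : ‖ν‖ ^ 2 < 1 := by
    rw [← Complex.normSq_eq_norm_sq, Complex.normSq_apply]
    nlinarith
  exact (sq_lt_one_iff₀ (norm_nonneg _)).1 h2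

/-- The discrete-time Lyapunov sum: a Schur stable matrix contracts some quadratic form. -/
theorem Matrix.exists_stein {ι : Type*} [Fintype ι] [DecidableEq ι] (S : Matrix ι ι ℝ)
    (hS : ∀ ν ∈ spectrum ℂ (S.map Complex.ofReal), ‖ν‖ < 1) :
    ∃ P : Matrix ι ι ℝ, P.IsHermitian ∧ (P - 1).PosSemidef ∧ (P - Sᵀ * P * S).PosSemidef := by
  obtain ⟨m, hm, hnorm⟩ := Matrix.exists_pow_norm_le_one _ hS
  have hpsd : ∀ k, ((S ^ k)ᵀ * S ^ k).PosSemidef := fun k => by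
    simpa [conjTranspose_eq_transpose_of_trivial] using posSemidef_conjTranspose_mul_self (S ^ k)
  refine ⟨∑ k ∈ Finset.range m, (S ^ k)ᵀ * S ^ k, ?_, ?_, ?_⟩
  · exact (posSemidef_sum _ fun k _ => hpsd k).isHermitian
  · obtain ⟨l, rfl⟩ := Nat.exists_eq_add_of_le' hm
    rw [Finset.sum_range_succ']
    simpa using posSemidef_sum (Finset.range l) fun k _ => hpsd (k + 1)
  · have hmap : (S.map Complex.ofReal) ^ m = (S ^ m).map Complex.ofReal :=
      (map_pow (Complex.ofRealHom.mapMatrix) S m).symm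
    rw [hmap] at hnorm
    have hsucc : Sᵀ * (∑ k ∈ Finset.range m, (S ^ k)ᵀ * S ^ k) * S
        = ∑ k ∈ Finset.range m, (S ^ (k + 1))ᵀ * S ^ (k + 1) := by
      rw [Finset.mul_sum, Finset.sum_mul]
      refine Finset.sum_congr rfl fun k _ => ?_
      rw [pow_succ, transpose_mul]
      simp only [mul_assoc]
    rw [hsucc, ← Finset.sum_sub_distrib, Finset.sum_range_sub' (fun k => (S ^ k)ᵀ * S ^ k)]
    simpa using Matrix.posSemidef_one_sub_transpose_mul_self _ hnorm

/-- Lyapunov's theorem: a Hurwitz matrix dissipates some quadratic form bounded below by the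
identity. -/
theorem Matrix.exists_lyapunov {ι : Type*} [Fintype ι] [DecidableEq ι] (K : Matrix ι ι ℝ)
    (hK : ∀ μ ∈ spectrum ℂ (K.map Complex.ofReal), μ.re < 0) :
    ∃ P : Matrix ι ι ℝ, P.IsHermitian ∧ (P - 1).PosSemidef ∧ (-(Kᵀ * P + P * K)).PosSemidef := by
  set f : Matrix ι ι ℝ →+* Matrix ι ι ℂ := Complex.ofRealHom.mapMatrix with hf
  have hunit : IsUnit (1 - K).det := by
    rw [isUnit_iff_ne_zero]
    intro h0
    have h1 : (f (1 - K)).det = 0 := by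
      rw [hf, ← RingHom.map_det, h0, map_zero]
    obtain ⟨v, hv, hv0⟩ := Matrix.exists_mulVec_eq_zero_iff.2 h1
    rw [map_sub, map_one, Matrix.sub_mulVec, Matrix.one_mulVec, sub_eq_zero] at hv0
    have := hK 1 ((Matrix.mem_spectrum_iff_exists_mulVec_eq_smul _ _).2
      ⟨v, hv, by rw [one_smul]; exact hv0.symm⟩)
    norm_num at this
  set S := (1 + K) * (1 - K)⁻¹ with hS
  have hSD : S * (1 - K) = 1 + K := by
    rw [hS, mul_assoc, Matrix.nonsing_inv_mul _ hunit, mul_one]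
  obtain ⟨P, hP, hP1, hPS⟩ := Matrix.exists_stein S fun ν hν => by
    obtain ⟨u, hu, hSu⟩ := (Matrix.mem_spectrum_iff_exists_mulVec_eq_smul _ _).1 hν
    have huw : f (1 - K) *ᵥ (f (1 - K)⁻¹ *ᵥ u) = u := by
      rw [Matrix.mulVec_mulVec, ← map_mul, Matrix.mul_nonsing_inv _ hunit, map_one,
        Matrix.one_mulVec]
    set w := f (1 - K)⁻¹ *ᵥ u
    have hw : w ≠ 0 := by
      rintro h0
      rw [h0, Matrix.mulVec_zero] at huw
      exact hu huw.symm
    have hKw : f (1 + K) *ᵥ w = ν • (f (1 - K) *ᵥ w) := by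
      rw [← hSD, map_mul, ← Matrix.mulVec_mulVec, huw]
      exact hSu
    simp only [map_add, map_sub, map_one, Matrix.add_mulVec, Matrix.sub_mulVec,
      Matrix.one_mulVec] at hKw
    have hKw' : (ν + 1) • (f K *ᵥ w) = (ν - 1) • w := by
      rw [smul_sub] at hKw
      rw [add_smul, sub_smul, one_smul, one_smul, ← sub_eq_zero]
      rw [← sub_eq_zero] at hKw
      rw [← hKw]
      abel
    have hν1 : ν + 1 ≠ 0 := by
      intro h0
      rw [h0, zero_smul] at hKw'
      have := (smul_eq_zero.1 hKw'.symm).resolve_right hw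
      rw [eq_neg_of_add_eq_zero_left h0] at this
      norm_num at this
    refine Complex.norm_lt_one_of_re_cayley_neg hν1 (hK _ ?_)
    refine (Matrix.mem_spectrum_iff_exists_mulVec_eq_smul _ _).2 ⟨w, hw, ?_⟩
    rw [div_eq_inv_mul, mul_smul, ← hKw', smul_smul, inv_mul_cancel₀ hν1, one_smul]
    rfl
  refine ⟨P, hP, hP1, ?_⟩
  have h := (hPS.conjTranspose_mul_mul_same (1 - K)).smul (show (0 : ℝ) ≤ 1 / 2 by norm_num)
  convert h using 1
  have h2 : (1 - K)ᵀ * (Sᵀ * P * S) * (1 - K) = (1 + K)ᵀ * P * (1 + K) := by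
    simp only [← hSD, transpose_mul, mul_assoc]
  rw [conjTranspose_eq_transpose_of_trivial, mul_sub _ P, sub_mul _ _ (1 - K), h2]
  simp only [transpose_sub, transpose_add, transpose_one, sub_mul, mul_sub, add_mul, mul_add,
    one_mul, mul_one]
  module

theorem Matrix.exists_lyapunov_rate {ι : Type*} [Fintype ι] [DecidableEq ι] (M : Matrix ι ι ℝ)
    (a : ℝ) (hM : ∀ μ ∈ spectrum ℂ (M.map Complex.ofReal), μ.re < -a) :
    ∃ α > a, ∃ P : Matrix ι ι ℝ, P.IsHermitian ∧ (P - 1).PosSemidef ∧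
      (-((2 * α) • P) - (Mᵀ * P + P * M)).PosSemidef := by
  obtain ⟨α, hα, hlt⟩ : ∃ α > a, ∀ μ ∈ spectrum ℂ (M.map Complex.ofReal), μ.re < -α := by
    have hfin : (spectrum ℂ (M.map Complex.ofReal)).Finite := Matrix.finite_spectrum _
    have h := (hfin.eventually_all (l := nhdsWithin a (Set.Ioi a))
      (p := fun μ α => μ.re < -α)).2 fun μ hμ =>
        ((continuous_neg.tendsto a).eventually_const_lt (hM μ hμ)).filter_mono nhdsWithin_le_nhds
    obtain ⟨α, h1, h2⟩ := (h.and self_mem_nhdsWithin).exists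
    exact ⟨α, h2, h1⟩
  obtain ⟨P, hP, hP1, hPM⟩ := Matrix.exists_lyapunov (M + α • 1) fun μ hμ => by
    obtain ⟨v, hv, hMv⟩ := (Matrix.mem_spectrum_iff_exists_mulVec_eq_smul _ _).1 hμ
    have hmap : (M + α • 1).map Complex.ofReal
        = M.map Complex.ofReal + (α : ℂ) • (1 : Matrix ι ι ℂ) := by
      ext i j
      by_cases hij : i = j <;> simp [hij]
    rw [hmap, Matrix.add_mulVec, Matrix.smul_mulVec, Matrix.one_mulVec] at hMv
    have := hlt (μ - α) ((Matrix.mem_spectrum_iff_exists_mulVec_eq_smul _ _).2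
      ⟨v, hv, by rw [sub_smul, ← hMv, add_sub_cancel_right]⟩)
    simp at this
    linarith
  refine ⟨α, hα, P, hP, hP1, ?_⟩
  convert hPM using 1
  simp only [transpose_add, transpose_smul, transpose_one, add_mul, mul_add, Matrix.smul_mul,
    Matrix.mul_smul, one_mul, mul_one]
  module

/-- Continuous time: if every matrix `A - λBC` (over the reduced Laplacian eigenvalues `λ`)
has spectral abscissa `< -α⋆`, then there exist `α > α⋆`, `c₁, c₂ > 0` and a symmetric
positive semidefinite `P` with `c₁ ΨᵀΨ ⪯ P ⪯ c₂ ΨᵀΨ` and `AAᵀP + P·AA ⪯ -2αP`. -/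
theorem ct_lyapunov_function_exists
    (N n : ℕ) (hN : 1 ≤ N) (W : Matrix (Fin N) (Fin N) ℝ)
    (hW : ∀ i j, 0 ≤ W i j) (hdiag : ∀ i, W i i = 0)
    (L : Matrix (Fin N) (Fin N) ℝ)
    (hL : L = Matrix.diagonal (W *ᵥ (fun _ => 1)) - W)
    (A : Matrix (Fin n) (Fin n) ℝ) (B : Matrix (Fin n) (Fin 1) ℝ)
    (C : Matrix (Fin 1) (Fin n) ℝ)
    (AA : Matrix (Fin N × Fin n) (Fin N × Fin n) ℝ)
    (hAA : AA = (1 : Matrix (Fin N) (Fin N) ℝ) ⊗ₖ A - L ⊗ₖ (B * C))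
    (Ψ : Matrix (Fin N × Fin n) (Fin N × Fin n) ℝ)
    (hΨ : Ψ = ((1 : Matrix (Fin N) (Fin N) ℝ)
        - (N : ℝ)⁻¹ • Matrix.of (fun _ _ => (1 : ℝ))) ⊗ₖ (1 : Matrix (Fin n) (Fin n) ℝ))
    (αs : ℝ) (hαs : 0 ≤ αs)
    (hspec : ∀ lam : ℂ, ((L.map (Complex.ofReal)).charpoly / Polynomial.X).IsRoot lam →
        ∀ μ ∈ spectrum ℂ (A.map (Complex.ofReal) - lam • (B * C).map (Complex.ofReal)),
          μ.re < -αs) :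
    ∃ α > αs, ∃ c₁ > (0 : ℝ), ∃ c₂ > (0 : ℝ),
      ∃ P : Matrix (Fin N × Fin n) (Fin N × Fin n) ℝ,
        Pᵀ = P ∧ P.PosSemidef ∧
        (P - c₁ • (Ψᵀ * Ψ)).PosSemidef ∧
        (c₂ • (Ψᵀ * Ψ) - P).PosSemidef ∧
        (-((2 * α) • P) - (AAᵀ * P + P * AA)).PosSemidef := by
  have hN0 : (N : ℝ) ≠ 0 := Nat.cast_ne_zero.2 (by omega)
  have : Nonempty (Fin N) := ⟨⟨0, hN⟩⟩
  set J : Matrix (Fin N) (Fin N) ℝ := (N : ℝ)⁻¹ • Matrix.of (fun _ _ => (1 : ℝ)) with hJ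
  have hLJ : L * J = 0 := by
    ext i j
    simp [hL, hJ, Matrix.mul_apply, Matrix.sub_apply, Matrix.diagonal_apply, Matrix.mulVec,
      dotProduct, ← Finset.sum_mul]
  have hJJ : J * J = J := by
    ext i j
    simp [hJ, Matrix.mul_apply]
    field_simp
  have hJP : J * (1 - J) = 0 := by rw [mul_sub, hJJ, mul_one, sub_self]
  have hPP : (1 - J) * (1 - J) = 1 - J := by rw [sub_mul, hJP, one_mul, sub_zero]
  have hLP : L * (1 - J) = L := by rw [mul_sub, hLJ, mul_one, sub_zero]
  set M := (1 - J) ⊗ₖ A - ((1 - J) * L) ⊗ₖ (B * C)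
    - (αs + 1) • (J ⊗ₖ (1 : Matrix (Fin n) (Fin n) ℝ)) with hM
  have hMΨ : M * Ψ = Ψ * AA := by
    rw [hM, hAA, hΨ]
    simp only [sub_mul _ _ ((1 - J) ⊗ₖ (1 : Matrix (Fin n) (Fin n) ℝ)), mul_sub ((1 - J) ⊗ₖ _),
      Matrix.smul_mul, ← Matrix.mul_kronecker_mul, mul_assoc, hLP, hJP, hPP, one_mul, mul_one]
    simp
  have hmap : M.map Complex.ofReal = (1 - J.map Complex.ofReal) ⊗ₖ A.map Complex.ofReal
      - ((1 - J.map Complex.ofReal) * L.map Complex.ofReal) ⊗ₖ (B * C).map Complex.ofReal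
      - ((αs + 1 : ℝ) : ℂ) • (J.map Complex.ofReal ⊗ₖ (1 : Matrix (Fin n) (Fin n) ℂ)) := by
    have h1 : (1 - J).map Complex.ofReal = 1 - J.map Complex.ofReal :=
      (map_sub Complex.ofRealHom.mapMatrix 1 J).trans (by rw [map_one]; rfl)
    have h2 : ((1 - J) * L).map Complex.ofReal
        = (1 - J.map Complex.ofReal) * L.map Complex.ofReal := by
      rw [← h1]
      exact map_mul Complex.ofRealHom.mapMatrix (1 - J) L
    rw [← h2, ← h1]
    ext ⟨i, k⟩ ⟨j, l⟩
    by_cases hkl : k = l <;> simp [hM, hkl]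
  have hMspec : ∀ μ ∈ spectrum ℂ (M.map Complex.ofReal), μ.re < -αs := by
    intro μ hμ
    rw [hmap] at hμ
    have hJc : J.map Complex.ofReal
        = (Fintype.card (Fin N) : ℂ)⁻¹ • Matrix.of fun _ _ => (1 : ℂ) := by
      ext i j
      simp [hJ]
    have hLJc : L.map Complex.ofReal * J.map Complex.ofReal = 0 :=
      (map_mul Complex.ofRealHom.mapMatrix L J).symm.trans (by rw [hLJ, map_zero])
    rcases spectrum_disagreement hJc hLJc _ _ _ hμ with h | ⟨lam, hlam, hmem⟩
    · simp [h]
    · exact hspec lam hlam μ hmem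
  obtain ⟨α, hα, P, hP, hP1, hPM⟩ := Matrix.exists_lyapunov_rate M αs hMspec
  obtain ⟨c, hc, hcP⟩ := Matrix.exists_posSemidef_smul_one_sub hP
  have hPpsd : P.PosSemidef := by simpa using hP1.add PosSemidef.one
  have hconj : ∀ {Q : Matrix (Fin N × Fin n) (Fin N × Fin n) ℝ}, Q.PosSemidef →
      (Ψᵀ * Q * Ψ).PosSemidef := fun hQ => by
    simpa [conjTranspose_eq_transpose_of_trivial] using hQ.conjTranspose_mul_mul_same Ψ
  refine ⟨α, hα, 1, one_pos, c, hc, Ψᵀ * P * Ψ, ?_, hconj hPpsd, ?_, ?_, ?_⟩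
  · simpa [IsHermitian, conjTranspose_eq_transpose_of_trivial] using (hconj hPpsd).isHermitian
  · convert hconj hP1 using 1
    rw [mul_sub, sub_mul, mul_one, one_smul]
  · convert hconj hcP using 1
    rw [mul_sub, sub_mul, Matrix.mul_smul, mul_one, Matrix.smul_mul]
  · convert hconj hPM using 1
    have h1 : AAᵀ * (Ψᵀ * P * Ψ) = Ψᵀ * (Mᵀ * P) * Ψ := by
      rw [← mul_assoc, ← mul_assoc, ← transpose_mul, ← hMΨ, transpose_mul]
      simp only [mul_assoc]
    have h2 : Ψᵀ * P * Ψ * AA = Ψᵀ * (P * M) * Ψ := by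
      rw [mul_assoc _ Ψ, ← hMΨ]
      simp only [mul_assoc]
    rw [h1, h2]
    simp only [mul_sub, sub_mul, mul_add, add_mul, mul_neg, neg_mul, Matrix.mul_smul,
      Matrix.smul_mul]
end

section
/- Suppose there exist M > 0 and α ∈ (0,1) such that ‖Ψ 𝐀^t x₀‖ ≤ M α^t ‖Ψ x₀‖ for all x₀ ∈ ℝ^{Nn} and t ∈ ℕ, and let p ∈ ℝ^N be a nonzero vector with nonnegative entries satisfying pᵀL = 0 (so pᵀ𝟙_N > 0). Then there exists C > 0 such that for every x₀ ∈ ℝ^{Nn} and every t ∈ ℕ, ‖𝐀^t x₀ − 𝟙_N ⊗ (A^t x̃₀)‖ ≤ C α^t ‖Ψ x₀‖, where x̃₀ := (1/(pᵀ𝟙_N)) (pᵀ ⊗ I_n) x₀; i.e., the agents' states uniformly globally exponentially synchronize to the solution of the initial value problem x̃⁺ = Ax̃, x̃(0) = x̃₀. -/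
open Matrix
open scoped Kronecker

/-- The Euclidean norm on `ℝ^ι`. -/
noncomputable def euclNorm {ι : Type*} [Fintype ι] (v : ι → ℝ) : ℝ :=
  Real.sqrt (∑ i, v i ^ 2)

theorem euclNorm_eq_norm_toLp {ι : Type*} [Fintype ι] (v : ι → ℝ) :
    euclNorm v = ‖WithLp.toLp 2 v‖ := by
  simp [euclNorm, EuclideanSpace.norm_eq]

theorem exists_euclNorm_mulVec_le {ι : Type*} [Fintype ι] [DecidableEq ι] (Q : Matrix ι ι ℝ) :
    ∃ c > (0 : ℝ), ∀ v : ι → ℝ, euclNorm (Q *ᵥ v) ≤ c * euclNorm v := by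
  obtain ⟨c, hc, h⟩ := (Matrix.toEuclideanCLM (𝕜 := ℝ) Q).bound
  refine ⟨c, hc, fun v => ?_⟩
  simpa [euclNorm_eq_norm_toLp] using h (WithLp.toLp 2 v)

/-- The weighted aggregation `pᵀ ⊗ I_n` acts by weighted sums over the nodes. -/
theorem weightedSum_mulVec_apply {N n : ℕ} (p : Fin N → ℝ) (v : Fin N × Fin n → ℝ) (k : Fin n) :
    (Matrix.of (fun k (q : Fin N × Fin n) => p q.1 * (1 : Matrix (Fin n) (Fin n) ℝ) q.2 k) *ᵥ v) k
      = ∑ i, p i * v (i, k) := by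
  simp [Matrix.mulVec, dotProduct, Fintype.sum_prod_type, Matrix.one_apply]

theorem centering_mulVec_apply {N n : ℕ} (v : Fin N × Fin n → ℝ) (i : Fin N) (k : Fin n) :
    ((((1 : Matrix (Fin N) (Fin N) ℝ) - (N : ℝ)⁻¹ • Matrix.of (fun _ _ => (1 : ℝ)))
      ⊗ₖ (1 : Matrix (Fin n) (Fin n) ℝ)) *ᵥ v) (i, k) = v (i, k) - (N : ℝ)⁻¹ * ∑ j, v (j, k) := by
  simp [Matrix.mulVec, dotProduct, Fintype.sum_prod_type, Matrix.one_apply, sub_mul,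
    Finset.sum_sub_distrib, Finset.mul_sum]

/-- A left null vector of `L` intertwines the networked dynamics with the nodal dynamics. -/
theorem weightedSum_mul_closedLoop {N n : ℕ} (p : Fin N → ℝ) (L : Matrix (Fin N) (Fin N) ℝ)
    (hp : p ᵥ* L = 0) (A F : Matrix (Fin n) (Fin n) ℝ) :
    Matrix.of (fun k (q : Fin N × Fin n) => p q.1 * (1 : Matrix (Fin n) (Fin n) ℝ) q.2 k)
        * ((1 : Matrix (Fin N) (Fin N) ℝ) ⊗ₖ A - L ⊗ₖ F)
      = A * Matrix.of (fun k (q : Fin N × Fin n) =>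
        p q.1 * (1 : Matrix (Fin n) (Fin n) ℝ) q.2 k) := by
  ext k ⟨j, l⟩
  have h : ∑ i, p i * L i j = 0 := congrFun hp j
  have h' : ∑ i, p i * (L i j * F k l) = 0 := by
    simp_rw [← mul_assoc, ← Finset.sum_mul, h, zero_mul]
  simp [Matrix.mul_apply, Fintype.sum_prod_type, Matrix.one_apply, mul_sub,
    Finset.sum_sub_distrib, h', mul_comm]

/-- Discrete time: if the synchronization set is UGES with rate `α ∈ (0,1)` for the closed
loop `x⁺ = AA x`, and `p ≥ 0` is a nonzero left null vector of `L` (so `pᵀ𝟙 > 0`), then all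
agents exponentially synchronize to the solution of `x̃⁺ = A x̃` started from the
`p`-weighted average `x̃₀ = (1/pᵀ𝟙)(pᵀ ⊗ I_n)x₀`. -/
theorem dt_uges_implies_sync_to_ivp
    (N n : ℕ) (hN : 1 ≤ N) (W : Matrix (Fin N) (Fin N) ℝ)
    (hW : ∀ i j, 0 ≤ W i j) (hdiag : ∀ i, W i i = 0)
    (L : Matrix (Fin N) (Fin N) ℝ)
    (hL : L = Matrix.diagonal (W *ᵥ (fun _ => 1)) - W)
    (A : Matrix (Fin n) (Fin n) ℝ) (B : Matrix (Fin n) (Fin 1) ℝ)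
    (C : Matrix (Fin 1) (Fin n) ℝ)
    (AA : Matrix (Fin N × Fin n) (Fin N × Fin n) ℝ)
    (hAA : AA = (1 : Matrix (Fin N) (Fin N) ℝ) ⊗ₖ A - L ⊗ₖ (B * C))
    (Ψ : Matrix (Fin N × Fin n) (Fin N × Fin n) ℝ)
    (hΨ : Ψ = ((1 : Matrix (Fin N) (Fin N) ℝ)
        - (N : ℝ)⁻¹ • Matrix.of (fun _ _ => (1 : ℝ))) ⊗ₖ (1 : Matrix (Fin n) (Fin n) ℝ))
    (M α : ℝ) (hM : 0 < M) (hα : 0 < α) (hα1 : α < 1)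
    (hUGES : ∀ x₀ : Fin N × Fin n → ℝ, ∀ t : ℕ,
      euclNorm (Ψ *ᵥ (AA ^ t *ᵥ x₀)) ≤ M * α ^ t * euclNorm (Ψ *ᵥ x₀))
    (p : Fin N → ℝ) (hpne : p ≠ 0) (hpnn : ∀ i, 0 ≤ p i) (hp : p ᵥ* L = 0)
    (K : Matrix (Fin n) (Fin N × Fin n) ℝ)
    (hK : K = Matrix.of (fun k (q : Fin N × Fin n) => p q.1 * (1 : Matrix (Fin n) (Fin n) ℝ) q.2 k)) :
    0 < ∑ i, p i ∧
    ∃ c > (0 : ℝ), ∀ x₀ : Fin N × Fin n → ℝ, ∀ t : ℕ,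
      euclNorm
        (AA ^ t *ᵥ x₀ - fun q => (A ^ t *ᵥ ((∑ i, p i)⁻¹ • (K *ᵥ x₀))) q.2) ≤
        c * α ^ t * euclNorm (Ψ *ᵥ x₀) := by
  have hs : 0 < ∑ i, p i := by
    obtain ⟨i, hi⟩ := Function.ne_iff.mp hpne
    exact Finset.sum_pos' (fun i _ => hpnn i)
      ⟨i, Finset.mem_univ i, lt_of_le_of_ne (hpnn i) (Ne.symm hi)⟩
  refine ⟨hs, ?_⟩
  let Q : Matrix (Fin N × Fin n) (Fin N × Fin n) ℝ :=
    1 - Matrix.of (fun q r => ((∑ i, p i)⁻¹ • K) q.2 r)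
  have hQ (v : Fin N × Fin n → ℝ) :
      Q *ᵥ v = v - fun q => ((∑ i, p i)⁻¹ • (K *ᵥ v)) q.2 := by
    rw [Matrix.sub_mulVec, Matrix.one_mulVec, ← Matrix.smul_mulVec]
    rfl
  have hQΨ (v : Fin N × Fin n → ℝ) : Q *ᵥ (Ψ *ᵥ v) = Q *ᵥ v := by
    ext ⟨i, k⟩
    simp only [hQ, hK, hΨ, Pi.sub_apply, Pi.smul_apply, smul_eq_mul, weightedSum_mulVec_apply,
      centering_mulVec_apply, mul_sub, Finset.sum_sub_distrib, ← Finset.sum_mul]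
    field_simp
    ring
  have hKA : K * AA = A * K := by
    rw [hK, hAA]
    exact weightedSum_mul_closedLoop p L hp A (B * C)
  have hKpow (t : ℕ) : K * AA ^ t = A ^ t * K := by
    induction t with
    | zero => simp
    | succ t ih => rw [pow_succ, ← Matrix.mul_assoc, ih, Matrix.mul_assoc, hKA, pow_succ, Matrix.mul_assoc]
  obtain ⟨c, hc, hbound⟩ := exists_euclNorm_mulVec_le Q
  refine ⟨c * M, mul_pos hc hM, fun x₀ t => ?_⟩
  have hy : AA ^ t *ᵥ x₀ - (fun q => (A ^ t *ᵥ ((∑ i, p i)⁻¹ • (K *ᵥ x₀))) q.2)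
      = Q *ᵥ (Ψ *ᵥ (AA ^ t *ᵥ x₀)) := by
    rw [hQΨ, hQ, Matrix.mulVec_smul, Matrix.mulVec_mulVec, Matrix.mulVec_mulVec, hKpow]
  calc _ ≤ c * euclNorm (Ψ *ᵥ (AA ^ t *ᵥ x₀)) := by rw [hy]; exact hbound _
    _ ≤ c * (M * α ^ t * euclNorm (Ψ *ᵥ x₀)) := by gcongr; exact hUGES x₀ t
    _ = c * M * α ^ t * euclNorm (Ψ *ᵥ x₀) := by ring
end
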